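/- arXiv:2108.13091 — 5 statements merged into one kernel-verified Lean document; each statement's English description precedes it below -/
import Mathlib

section
/- Let n_r, n_c, d_r, d_c be positive integers and set N_r = n_r·d_r, N_c = n_c·d_c, d = d_r·d_c. Let F denote the unitary 2D discrete Fourier transform on ℂ-valued images indexed by ZMod N_r × ZMod N_c, and let S be the decimation operator with zero-filling adjoint S^H. Then the matrix of the composite operator F ∘ S^H ∘ S ∘ F^H has entries: its ((p,q),(p',q')) entry equals 1/d if p ≡ p' (mod n_r) and q ≡ q' (mod n_c), and equals 0 otherwise. (Equivalently, F S^H S F^H = (1/d)·(J_{d_r} ⊗ I_{n_r}) ⊗ (J_{d_c} ⊗ I_{n_c}) up to the canonical index identification.) -/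
open scoped BigOperators

/-- Unitary 2D discrete Fourier transform on images indexed by `ZMod a × ZMod b`. -/
noncomputable def dft2 (a b : ℕ) [NeZero a] [NeZero b]
    (x : ZMod a × ZMod b → ℂ) : ZMod a × ZMod b → ℂ := fun pq =>
  (1 / (Real.sqrt ((a : ℝ) * b) : ℂ)) *
    ∑ ij : ZMod a × ZMod b,
      Complex.exp (-(2 * (Real.pi : ℂ)) * Complex.I *
        (((pq.1.val * ij.1.val : ℕ) : ℂ) / (a : ℂ) +
         ((pq.2.val * ij.2.val : ℕ) : ℂ) / (b : ℂ))) * x ij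

/-- Inverse (conjugate transpose) of the unitary 2D DFT. -/
noncomputable def idft2 (a b : ℕ) [NeZero a] [NeZero b]
    (x : ZMod a × ZMod b → ℂ) : ZMod a × ZMod b → ℂ := fun pq =>
  (1 / (Real.sqrt ((a : ℝ) * b) : ℂ)) *
    ∑ ij : ZMod a × ZMod b,
      Complex.exp ((2 * (Real.pi : ℂ)) * Complex.I *
        (((pq.1.val * ij.1.val : ℕ) : ℂ) / (a : ℂ) +
         ((pq.2.val * ij.2.val : ℕ) : ℂ) / (b : ℂ))) * x ij

/-- Decimation operator `S`: `(S x)(i,j) = x (d_r·i, d_c·j)`. -/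
def decim (n_r n_c d_r d_c : ℕ) {α : Type*}
    (x : ZMod (n_r * d_r) × ZMod (n_c * d_c) → α) :
    ZMod n_r × ZMod n_c → α := fun ij =>
  x (((d_r * ij.1.val : ℕ) : ZMod (n_r * d_r)), ((d_c * ij.2.val : ℕ) : ZMod (n_c * d_c)))

/-- Zero-filling adjoint `S^H` of the decimation operator. -/
def zfill (n_r n_c d_r d_c : ℕ) {α : Type*} [Zero α]
    (y : ZMod n_r × ZMod n_c → α) :
    ZMod (n_r * d_r) × ZMod (n_c * d_c) → α := fun pq =>
  if d_r ∣ pq.1.val ∧ d_c ∣ pq.2.val then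
    y (((pq.1.val / d_r : ℕ) : ZMod n_r), ((pq.2.val / d_c : ℕ) : ZMod n_c))
  else 0

/-- Circular sample autocorrelation of a real image. -/
def acorr (a b : ℕ) [NeZero a] [NeZero b] (e : ZMod a × ZMod b → ℝ) :
    ZMod a × ZMod b → ℝ := fun lm =>
  ∑ ij : ZMod a × ZMod b, e ij * e (ij.1 + lm.1, ij.2 + lm.2)

theorem ZMod.sum_val_eq_sum_range {M : Type*} [AddCommMonoid M] (N : ℕ) [NeZero N] (f : ℕ → M) :
    ∑ i : ZMod N, f i.val = ∑ k ∈ Finset.range N, f k := by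
  refine Finset.sum_nbij ZMod.val (fun i _ => Finset.mem_range.2 i.val_lt)
    (ZMod.val_injective N).injOn (fun k hk => ?_) (fun _ _ => rfl)
  exact ⟨(k : ZMod N), Finset.mem_coe.2 (Finset.mem_univ _),
    ZMod.val_cast_of_lt (Finset.mem_range.1 hk)⟩

theorem Finset.sum_range_mul_dvd {M : Type*} [AddCommMonoid M] (n d : ℕ) [NeZero d] (f : ℕ → M) :
    ∑ k ∈ Finset.range (n * d), (if d ∣ k then f k else 0)
      = ∑ k ∈ Finset.range n, f (d * k) := by
  have hd : 0 < d := Nat.pos_of_neZero d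
  rw [← Finset.sum_filter]
  symm
  refine Finset.sum_nbij (d * ·) (fun k hk => ?_) (fun a _ b _ h => ?_) (fun k hk => ?_)
    (fun _ _ => rfl)
  · rw [Finset.mem_filter, Finset.mem_range, mul_comm n]
    exact ⟨Nat.mul_lt_mul_of_pos_left (Finset.mem_range.1 hk) hd, dvd_mul_right _ _⟩
  · exact Nat.eq_of_mul_eq_mul_left hd h
  · rw [Finset.mem_coe, Finset.mem_filter, Finset.mem_range] at hk
    obtain ⟨hlt, c, rfl⟩ := hk
    rw [mul_comm n] at hlt
    exact ⟨c, Finset.mem_coe.2 (Finset.mem_range.2 (Nat.lt_of_mul_lt_mul_left hlt)), rfl⟩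

theorem IsPrimitiveRoot.sum_range_zpow_pow {K : Type*} [Field K] {ζ : K} {n : ℕ}
    (hζ : IsPrimitiveRoot ζ n) (m : ℤ) :
    ∑ k ∈ Finset.range n, (ζ ^ m) ^ k = if (n : ℤ) ∣ m then (n : K) else 0 := by
  split_ifs with h
  · simp [(hζ.zpow_eq_one_iff_dvd m).2 h]
  · have h1 : ζ ^ m - 1 ≠ 0 := sub_ne_zero.2 fun h1 => h ((hζ.zpow_eq_one_iff_dvd m).1 h1)
    refine (mul_eq_zero.1 ?_).resolve_left h1
    rw [mul_geom_sum, ← zpow_natCast, zpow_comm, zpow_natCast, hζ.pow_eq_one, one_zpow, sub_self]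

/-- Orthogonality of the Fourier characters of `ZMod (n * d)` restricted to the multiples
of `d`. -/
theorem sum_dvd_exp_mul_exp (n d p p' : ℕ) [NeZero n] [NeZero d] :
    ∑ i : ZMod (n * d), (if d ∣ i.val then
        Complex.exp (-(2 * (Real.pi : ℂ)) * Complex.I *
            (((p * i.val : ℕ) : ℂ) / ((n * d : ℕ) : ℂ))) *
          Complex.exp (2 * (Real.pi : ℂ) * Complex.I *
            (((i.val * p' : ℕ) : ℂ) / ((n * d : ℕ) : ℂ))) else 0)
      = if p % n = p' % n then (n : ℂ) else 0 := by
  have hn : (n : ℂ) ≠ 0 := Nat.cast_ne_zero.2 (NeZero.ne n)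
  have hd : (d : ℂ) ≠ 0 := Nat.cast_ne_zero.2 (NeZero.ne d)
  rw [ZMod.sum_val_eq_sum_range (n * d) fun i => if d ∣ i then
        Complex.exp (-(2 * (Real.pi : ℂ)) * Complex.I *
            (((p * i : ℕ) : ℂ) / ((n * d : ℕ) : ℂ))) *
          Complex.exp (2 * (Real.pi : ℂ) * Complex.I *
            (((i * p' : ℕ) : ℂ) / ((n * d : ℕ) : ℂ))) else 0,
    Finset.sum_range_mul_dvd]
  have hdvd : p % n = p' % n ↔ (n : ℤ) ∣ (p' : ℤ) - p := Nat.modEq_iff_dvd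
  simp only [hdvd]
  rw [← (Complex.isPrimitiveRoot_exp n (NeZero.ne n)).sum_range_zpow_pow]
  refine Finset.sum_congr rfl fun k _ => ?_
  rw [← Complex.exp_int_mul, ← Complex.exp_nat_mul, ← Complex.exp_add]
  congr 1
  push_cast
  field_simp
  ring

theorem zfill_decim (n_r n_c d_r d_c : ℕ) [NeZero n_r] [NeZero n_c] [NeZero d_r] [NeZero d_c]
    {α : Type*} [Zero α] (x : ZMod (n_r * d_r) × ZMod (n_c * d_c) → α)
    (ij : ZMod (n_r * d_r) × ZMod (n_c * d_c)) :
    zfill n_r n_c d_r d_c (decim n_r n_c d_r d_c x) ij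
      = if d_r ∣ ij.1.val ∧ d_c ∣ ij.2.val then x ij else 0 := by
  have key (n d : ℕ) [NeZero n] [NeZero d] (i : ZMod (n * d)) (h : d ∣ i.val) :
      ((d * ((i.val / d : ℕ) : ZMod n).val : ℕ) : ZMod (n * d)) = i := by
    rw [ZMod.val_cast_of_lt (Nat.div_lt_of_lt_mul (mul_comm n d ▸ i.val_lt)),
      Nat.mul_div_cancel' h, ZMod.natCast_zmod_val]
  unfold zfill decim
  refine if_ctx_congr Iff.rfl (fun h => ?_) fun _ => rfl
  rw [key n_r d_r _ h.1, key n_c d_c _ h.2]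

theorem idft2_delta (a b : ℕ) [NeZero a] [NeZero b] (rs pq : ZMod a × ZMod b) :
    idft2 a b (fun ij => if ij = rs then (1 : ℂ) else 0) pq
      = (1 / (Real.sqrt ((a : ℝ) * b) : ℂ)) *
        Complex.exp ((2 * (Real.pi : ℂ)) * Complex.I *
          (((pq.1.val * rs.1.val : ℕ) : ℂ) / (a : ℂ) +
           ((pq.2.val * rs.2.val : ℕ) : ℂ) / (b : ℂ))) := by
  simp [idft2]

/-- The matrix of `F ∘ S^H ∘ S ∘ F^H` (computed by applying the composite
operator to the delta image at `(p',q')` and reading off coordinate `(p,q)`) has entry `1/d`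
if `p ≡ p' (mod n_r)` and `q ≡ q' (mod n_c)`, and `0` otherwise. -/
theorem dft_zfill_decim_idft_matrix_entries
    (n_r n_c d_r d_c : ℕ) [NeZero n_r] [NeZero n_c] [NeZero d_r] [NeZero d_c]
    (p p' : ZMod (n_r * d_r)) (q q' : ZMod (n_c * d_c)) :
    dft2 (n_r * d_r) (n_c * d_c)
      (zfill n_r n_c d_r d_c (decim n_r n_c d_r d_c
        (idft2 (n_r * d_r) (n_c * d_c)
          (fun rs => if rs = (p', q') then (1 : ℂ) else 0)))) (p, q)
      = if p.val % n_r = p'.val % n_r ∧ q.val % n_c = q'.val % n_c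
        then (1 : ℂ) / ((d_r : ℂ) * (d_c : ℂ)) else 0 := by
  set A : ℂ := 1 / (Real.sqrt (((n_r * d_r : ℕ) : ℝ) * (n_c * d_c : ℕ)) : ℂ) with hA
  have hAA : A * A * (n_r * n_c) = 1 / ((d_r : ℂ) * (d_c : ℂ)) := by
    have hnr : (n_r : ℂ) ≠ 0 := Nat.cast_ne_zero.2 (NeZero.ne n_r)
    have hnc : (n_c : ℂ) ≠ 0 := Nat.cast_ne_zero.2 (NeZero.ne n_c)
    have hdr : (d_r : ℂ) ≠ 0 := Nat.cast_ne_zero.2 (NeZero.ne d_r)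
    have hdc : (d_c : ℂ) ≠ 0 := Nat.cast_ne_zero.2 (NeZero.ne d_c)
    rw [hA, div_mul_div_comm, ← Complex.ofReal_mul, Real.mul_self_sqrt (by positivity)]
    push_cast
    field_simp
  unfold dft2
  simp only [zfill_decim, idft2_delta]
  rw [← hA]
  have hsum := congrArg₂ (· * ·) (sum_dvd_exp_mul_exp n_r d_r p.val p'.val)
    (sum_dvd_exp_mul_exp n_c d_c q.val q'.val)
  simp only [Fintype.sum_mul_sum, ← Fintype.sum_prod_type', ite_zero_mul_ite_zero] at hsum
  rw [← hAA, ← mul_ite_zero, ← hsum, mul_assoc A A]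
  congr 1
  rw [Finset.mul_sum]
  refine Finset.sum_congr rfl fun ij _ => ?_
  split_ifs
  · rw [mul_add, mul_add, Complex.exp_add, Complex.exp_add]
    ring
  · simp
end

section
/- Let n_r, n_c, d_r, d_c be positive integers, N_r = n_r·d_r, N_c = n_c·d_c. Let r : ZMod n_r × ZMod n_c → ℝ and let u = S^H r : ZMod N_r × ZMod N_c → ℝ be its zero-filled interpolation. Then the circular autocorrelation of u is the zero-filled interpolation of the circular autocorrelation of r: (u ⋆ u)(l,m) = (r ⋆ r)(i,j) if (l,m) = (d_r·i, d_c·j) for some (i,j), and 0 otherwise. Consequently ‖u ⋆ u‖₂ = ‖r ⋆ r‖₂ and ‖u‖₂ = ‖r‖₂. -/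
open scoped BigOperators

namespace ZMod

/-- Multiplication by `d`, as a homomorphism from `ZMod n` to `ZMod (n * d)`. -/
def scaleHom (n d : ℕ) : ZMod n →+ ZMod (n * d) :=
  ZMod.lift n ⟨zmultiplesHom _ (d : ZMod (n * d)), by
    simp only [zmultiplesHom_apply, natCast_zsmul, nsmul_eq_mul]
    exact_mod_cast ZMod.natCast_self (n * d)⟩

lemma scaleHom_natCast (n d k : ℕ) : scaleHom n d (k : ZMod n) = ((d * k : ℕ) : ZMod (n * d)) := by
  rw [← Int.cast_natCast, scaleHom, ZMod.lift_coe]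
  simp [mul_comm]

variable {n d : ℕ} [NeZero n] [NeZero d]

lemma val_scaleHom (i : ZMod n) : (scaleHom n d i).val = d * i.val := by
  conv_lhs => rw [← ZMod.natCast_zmod_val i, scaleHom_natCast]
  refine ZMod.val_cast_of_lt ?_
  rw [mul_comm n d]
  exact Nat.mul_lt_mul_of_pos_left i.val_lt (NeZero.pos d)

lemma scaleHom_injective : Function.Injective (scaleHom n d) := fun i j h => by
  apply ZMod.val_injective n
  apply Nat.eq_of_mul_eq_mul_left (NeZero.pos d)
  rw [← val_scaleHom, ← val_scaleHom, h]

lemma scaleHom_val_div {x : ZMod (n * d)} (h : d ∣ x.val) :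
    scaleHom n d ((x.val / d : ℕ) : ZMod n) = x := by
  rw [scaleHom_natCast, Nat.mul_div_cancel' h, ZMod.natCast_zmod_val]

end ZMod

/-- The embedding `(i, j) ↦ (d_r·i, d_c·j)` of the coarse grid into the fine grid. -/
def gridHom (n_r n_c d_r d_c : ℕ) :
    ZMod n_r × ZMod n_c →+ ZMod (n_r * d_r) × ZMod (n_c * d_c) :=
  (ZMod.scaleHom n_r d_r).prodMap (ZMod.scaleHom n_c d_c)

section

variable {n_r n_c d_r d_c : ℕ} [NeZero n_r] [NeZero n_c] [NeZero d_r] [NeZero d_c]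

lemma gridHom_injective : Function.Injective (gridHom n_r n_c d_r d_c) :=
  ZMod.scaleHom_injective.prodMap ZMod.scaleHom_injective

lemma zfill_gridHom {α : Type*} [Zero α] (y : ZMod n_r × ZMod n_c → α)
    (x : ZMod n_r × ZMod n_c) :
    zfill n_r n_c d_r d_c y (gridHom n_r n_c d_r d_c x) = y x := by
  simp [zfill, gridHom, ZMod.val_scaleHom, NeZero.pos]

lemma zfill_of_notMem_range {α : Type*} [Zero α] (y : ZMod n_r × ZMod n_c → α)
    {p : ZMod (n_r * d_r) × ZMod (n_c * d_c)} (hp : p ∉ (gridHom n_r n_c d_r d_c).range) :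
    zfill n_r n_c d_r d_c y p = 0 :=
  if_neg fun h => hp ⟨(_, _),
    Prod.ext (ZMod.scaleHom_val_div h.1) (ZMod.scaleHom_val_div h.2)⟩

lemma sum_gridHom {M : Type*} [AddCommMonoid M]
    {f : ZMod (n_r * d_r) × ZMod (n_c * d_c) → M}
    (hf : ∀ p ∉ (gridHom n_r n_c d_r d_c).range, f p = 0) :
    ∑ p, f p = ∑ x, f (gridHom n_r n_c d_r d_c x) :=
  (Fintype.sum_of_injective _ gridHom_injective _ f hf fun _ => rfl).symm

lemma sum_zfill_sq (y : ZMod n_r × ZMod n_c → ℝ) :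
    ∑ p, zfill n_r n_c d_r d_c y p ^ 2 = ∑ x, y x ^ 2 := by
  rw [sum_gridHom fun p hp => by rw [zfill_of_notMem_range y hp, zero_pow two_ne_zero]]
  simp only [zfill_gridHom]

lemma acorr_zfill_eq (y : ZMod n_r × ZMod n_c → ℝ) :
    acorr (n_r * d_r) (n_c * d_c) (zfill n_r n_c d_r d_c y) =
      zfill n_r n_c d_r d_c (acorr n_r n_c y) := by
  funext p
  change ∑ q, zfill n_r n_c d_r d_c y q * zfill n_r n_c d_r d_c y (q + p) = _
  rw [sum_gridHom fun q hq => by rw [zfill_of_notMem_range y hq, zero_mul]]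
  by_cases hp : p ∈ (gridHom n_r n_c d_r d_c).range
  · obtain ⟨z, rfl⟩ := hp
    simp only [← map_add, zfill_gridHom]
    rfl
  · rw [zfill_of_notMem_range _ hp]
    refine Finset.sum_eq_zero fun x _ => ?_
    have hx : gridHom n_r n_c d_r d_c x ∈ (gridHom n_r n_c d_r d_c).range := ⟨x, rfl⟩
    rw [zfill_of_notMem_range y (mt (AddSubgroup.add_mem_cancel_left _ hx).1 hp), mul_zero]

end

/-- The circular autocorrelation of a zero-filled image is the zero-filled
interpolation of the autocorrelation, and the corresponding norms coincide. -/
theorem acorr_zfill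
    (n_r n_c d_r d_c : ℕ) [NeZero n_r] [NeZero n_c] [NeZero d_r] [NeZero d_c]
    (r : ZMod n_r × ZMod n_c → ℝ) :
    acorr (n_r * d_r) (n_c * d_c) (zfill n_r n_c d_r d_c r)
        = zfill n_r n_c d_r d_c (acorr n_r n_c r) ∧
    Real.sqrt (∑ lm : ZMod (n_r * d_r) × ZMod (n_c * d_c),
        (acorr (n_r * d_r) (n_c * d_c) (zfill n_r n_c d_r d_c r) lm) ^ 2)
      = Real.sqrt (∑ lm : ZMod n_r × ZMod n_c, (acorr n_r n_c r lm) ^ 2) ∧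
    Real.sqrt (∑ pq : ZMod (n_r * d_r) × ZMod (n_c * d_c),
        (zfill n_r n_c d_r d_c r pq) ^ 2)
      = Real.sqrt (∑ ij : ZMod n_r × ZMod n_c, (r ij) ^ 2) := by
  rw [acorr_zfill_eq, sum_zfill_sq, sum_zfill_sq]
  exact ⟨rfl, rfl, rfl⟩
end

section
/- Let n_r, n_c, d_r, d_c be positive integers, N_r = n_r·d_r, N_c = n_c·d_c, d = d_r·d_c. Let F be the unitary 2D DFT on ℂ-valued images indexed by ZMod N_r × ZMod N_c, S the decimation operator with zero-filling adjoint S^H. Let λ̂, γ̂_1, …, γ̂_s : ZMod N_r × ZMod N_c → ℂ, set K = F^H Λ F and L_j = F^H Γ_j F, where Λ, Γ_j denote pointwise multiplication by λ̂, γ̂_j; let ζ = Σ_j |γ̂_j|² and fix ε > 0, μ > 0. Let b be a ℂ-valued image on the low-resolution grid and v_1, …, v_s ℂ-valued images on the high-resolution grid. Then the function x ↦ (μ/2)·‖SKx − b‖₂² + (1/2)·Σ_j ‖L_j x − v_j‖₂² + (ε/2)·‖x‖₂² has a unique global minimizer x*(μ), and x*(μ) = F^H [ (μ/d)·Λ^H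 Q Λ + D ]^{-1} ( μ·Λ^H F S^H b + Σ_j Γ_j^H F v_j ), where Q is the residue-class summation operator (Q z)(p,q) = Σ_{(p',q') in the residue class of ((p mod n_r),(q mod n_c))} z(p',q'), and D is pointwise multiplication by ζ + ε. -/
open scoped BigOperators

open Matrix

section DiscreteFourier

open Complex

/-- The matrix of the unitary 2D discrete Fourier transform. -/
noncomputable def dftMatrix (a b : ℕ) [NeZero a] [NeZero b] :
    Matrix (ZMod a × ZMod b) (ZMod a × ZMod b) ℂ :=
  Matrix.of fun p i => (1 / (Real.sqrt ((a : ℝ) * b) : ℂ)) *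
    (ZMod.stdAddChar (-(p.1 * i.1)) * ZMod.stdAddChar (-(p.2 * i.2)))

/-- The matrix of the decimation operator. -/
def decimMatrix (n_r n_c d_r d_c : ℕ) :
    Matrix (ZMod n_r × ZMod n_c) (ZMod (n_r * d_r) × ZMod (n_c * d_c)) ℂ :=
  Matrix.of fun i p => if (((d_r * i.1.val : ℕ) : ZMod (n_r * d_r)),
    ((d_c * i.2.val : ℕ) : ZMod (n_c * d_c))) = p then 1 else 0

lemma stdAddChar_mul_eq_exp (n : ℕ) [NeZero n] (p i : ZMod n) :
    (ZMod.stdAddChar (p * i) : ℂ) =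
      exp (2 * Real.pi * I * (((p.val * i.val : ℕ) : ℂ) / n)) := by
  have h : p * i = (((p.val * i.val : ℕ) : ℤ) : ZMod n) := by simp
  rw [h, ZMod.stdAddChar_coe]
  congr 1
  push_cast
  ring

lemma stdAddChar_neg_mul_eq_exp (n : ℕ) [NeZero n] (p i : ZMod n) :
    (ZMod.stdAddChar (-(p * i)) : ℂ) =
      exp (-(2 * Real.pi) * I * (((p.val * i.val : ℕ) : ℂ) / n)) := by
  rw [AddChar.map_neg_eq_inv, stdAddChar_mul_eq_exp, ← exp_neg]
  congr 1
  ring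

lemma star_stdAddChar (n : ℕ) [NeZero n] (x : ZMod n) :
    star (ZMod.stdAddChar x : ℂ) = ZMod.stdAddChar (-x) :=
  (AddChar.map_neg_eq_conj _ _).symm

lemma dft2_eq_mulVec (a b : ℕ) [NeZero a] [NeZero b] (x : ZMod a × ZMod b → ℂ) :
    dft2 a b x = dftMatrix a b *ᵥ x := by
  ext p
  simp only [dft2, dftMatrix, Matrix.mulVec, dotProduct, Matrix.of_apply, Finset.mul_sum,
    stdAddChar_neg_mul_eq_exp, ← exp_add, ← mul_add, mul_assoc]

lemma idft2_eq_mulVec (a b : ℕ) [NeZero a] [NeZero b] (x : ZMod a × ZMod b → ℂ) :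
    idft2 a b x = (dftMatrix a b)ᴴ *ᵥ x := by
  ext p
  simp only [idft2, dftMatrix, Matrix.mulVec, dotProduct, Matrix.of_apply, Finset.mul_sum,
    Matrix.conjTranspose_apply, star_mul', star_stdAddChar, neg_neg]
  refine Finset.sum_congr rfl fun i _ => ?_
  rw [mul_comm i.1, mul_comm i.2, stdAddChar_mul_eq_exp, stdAddChar_mul_eq_exp, ← exp_add,
    ← mul_add, ← mul_assoc]
  simp

lemma decim_eq_mulVec (n_r n_c d_r d_c : ℕ) [NeZero n_r] [NeZero n_c] [NeZero d_r] [NeZero d_c]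
    (x : ZMod (n_r * d_r) × ZMod (n_c * d_c) → ℂ) :
    decim n_r n_c d_r d_c x = decimMatrix n_r n_c d_r d_c *ᵥ x := by
  ext i
  simp [decim, decimMatrix, Matrix.mulVec, dotProduct]

lemma natCast_mul_val_eq_iff (n d : ℕ) [NeZero n] [NeZero d] (i : ZMod n) (p : ZMod (n * d)) :
    ((d * i.val : ℕ) : ZMod (n * d)) = p ↔ d ∣ p.val ∧ i = ((p.val / d : ℕ) : ZMod n) := by
  have hd : 0 < d := Nat.pos_of_neZero d
  constructor
  · rintro rfl
    have h : d * i.val < n * d := by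
      rw [mul_comm n d]
      exact Nat.mul_lt_mul_of_pos_left i.val_lt hd
    rw [ZMod.val_cast_of_lt h]
    simp [hd]
  · rintro ⟨⟨k, hk⟩, rfl⟩
    have hkn : k < n := by
      have := p.val_lt
      rw [hk, mul_comm n d] at this
      exact lt_of_mul_lt_mul_left this hd.le
    rw [hk, Nat.mul_div_cancel_left _ hd, ZMod.val_cast_of_lt hkn, ← hk, ZMod.natCast_zmod_val]

lemma zfill_eq_mulVec (n_r n_c d_r d_c : ℕ) [NeZero n_r] [NeZero n_c] [NeZero d_r] [NeZero d_c]
    (y : ZMod n_r × ZMod n_c → ℂ) :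
    zfill n_r n_c d_r d_c y = (decimMatrix n_r n_c d_r d_c)ᴴ *ᵥ y := by
  ext p
  simp only [zfill, decimMatrix, Matrix.mulVec, dotProduct, Matrix.of_apply,
    Matrix.conjTranspose_apply, apply_ite (star : ℂ → ℂ), star_one, star_zero, ite_mul, one_mul,
    zero_mul, Prod.ext_iff, natCast_mul_val_eq_iff]
  split_ifs with h
  · rw [Finset.sum_eq_single (((p.1.val / d_r : ℕ) : ZMod n_r), ((p.2.val / d_c : ℕ) : ZMod n_c))]
    · simp [h]
    · intro i _ hi
      rw [if_neg]
      rintro ⟨⟨_, h1⟩, _, h2⟩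
      exact hi (Prod.ext h1 h2)
    · simp
  · symm
    refine Finset.sum_eq_zero fun i _ => if_neg ?_
    rintro ⟨⟨h1, _⟩, h2, _⟩
    exact h ⟨h1, h2⟩

lemma stdAddChar_neg_mul_decimated (n d : ℕ) [NeZero n] [NeZero d] (p : ZMod (n * d))
    (i : ZMod n) :
    (ZMod.stdAddChar (-(p * ((d * i.val : ℕ) : ZMod (n * d)))) : ℂ) =
      ZMod.stdAddChar (-((p.val : ZMod n) * i)) := by
  have h1 : -(p * ((d * i.val : ℕ) : ZMod (n * d))) =
      ((-(p.val * (d * i.val) : ℕ) : ℤ) : ZMod (n * d)) := by simp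
  have h2 : -((p.val : ZMod n) * i) = ((-(p.val * i.val : ℕ) : ℤ) : ZMod n) := by simp
  rw [h1, h2, ZMod.stdAddChar_coe, ZMod.stdAddChar_coe]
  congr 1
  have hn : (n : ℂ) ≠ 0 := NeZero.ne _
  have hd : (d : ℂ) ≠ 0 := NeZero.ne _
  push_cast
  field_simp

/-- Orthogonality of the additive characters of `ZMod n`. -/
lemma sum_stdAddChar_neg_mul (n : ℕ) [NeZero n] (p q : ZMod n) :
    ∑ i : ZMod n, (ZMod.stdAddChar (-(p * i)) : ℂ) * ZMod.stdAddChar (q * i) =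
      if p = q then (n : ℂ) else 0 := by
  have h := AddChar.sum_mulShift (q - p) (ZMod.isPrimitive_stdAddChar n)
  rw [ZMod.card] at h
  simp only [← AddChar.map_add_eq_mul]
  have h' : ∀ i, -(p * i) + q * i = i * (q - p) := fun i => by ring
  simp only [h', h, sub_eq_zero, eq_comm (a := q), apply_ite (Nat.cast : ℕ → ℂ), Nat.cast_zero]

lemma inv_sqrt_mul_self {x : ℝ} (hx : 0 ≤ x) :
    (1 / (Real.sqrt x : ℂ)) * (1 / (Real.sqrt x : ℂ)) = 1 / (x : ℂ) := by
  rw [div_mul_div_comm, one_mul, ← ofReal_mul, Real.mul_self_sqrt hx]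

lemma dftMatrix_mul_conjTranspose (a b : ℕ) [NeZero a] [NeZero b] :
    dftMatrix a b * (dftMatrix a b)ᴴ = 1 := by
  ext p q
  have ha : (a : ℂ) ≠ 0 := NeZero.ne _
  have hb : (b : ℂ) ≠ 0 := NeZero.ne _
  have key := congrArg₂ (· * ·) (sum_stdAddChar_neg_mul a p.1 q.1)
    (sum_stdAddChar_neg_mul b p.2 q.2)
  simp only [Finset.sum_mul_sum] at key
  rw [← Fintype.sum_prod_type'] at key
  have hs := inv_sqrt_mul_self (x := (a : ℝ) * b) (by positivity)
  simp only [Matrix.mul_apply, Matrix.conjTranspose_apply, dftMatrix, Matrix.of_apply, star_mul',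
    star_stdAddChar, neg_neg]
  have : ∀ i : ZMod a × ZMod b, (1 / (Real.sqrt ((a : ℝ) * b) : ℂ)) *
      (ZMod.stdAddChar (-(p.1 * i.1)) * ZMod.stdAddChar (-(p.2 * i.2))) *
      (star (1 / (Real.sqrt ((a : ℝ) * b) : ℂ)) *
        (ZMod.stdAddChar (q.1 * i.1) * ZMod.stdAddChar (q.2 * i.2))) =
      1 / (((a : ℝ) * b : ℝ) : ℂ) * (ZMod.stdAddChar (-(p.1 * i.1)) * ZMod.stdAddChar (q.1 * i.1) *
        (ZMod.stdAddChar (-(p.2 * i.2)) * ZMod.stdAddChar (q.2 * i.2))) := fun i => by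
    rw [← hs]
    simp only [star_div₀, star_one, Complex.star_def, conj_ofReal]
    ring
  simp only [this, ← Finset.mul_sum, key, Matrix.one_apply, Prod.ext_iff]
  by_cases h1 : p.1 = q.1 <;> by_cases h2 : p.2 = q.2 <;> simp [h1, h2]
  field_simp

lemma dftMatrix_conjTranspose_mul (a b : ℕ) [NeZero a] [NeZero b] :
    (dftMatrix a b)ᴴ * dftMatrix a b = 1 :=
  mul_eq_one_comm.mp (dftMatrix_mul_conjTranspose a b)

lemma decimMatrix_mul_dftMatrix_apply (n_r n_c d_r d_c : ℕ) [NeZero n_r] [NeZero n_c] [NeZero d_r]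
    [NeZero d_c] (i : ZMod n_r × ZMod n_c) (p : ZMod (n_r * d_r) × ZMod (n_c * d_c)) :
    (decimMatrix n_r n_c d_r d_c * (dftMatrix (n_r * d_r) (n_c * d_c))ᴴ) i p =
      (1 / (Real.sqrt (((n_r * d_r : ℕ) : ℝ) * (n_c * d_c : ℕ)) : ℂ)) *
        (ZMod.stdAddChar ((p.1.val : ZMod n_r) * i.1) *
          ZMod.stdAddChar ((p.2.val : ZMod n_c) * i.2)) := by
  simp only [Matrix.mul_apply, decimMatrix, Matrix.of_apply, ite_mul, one_mul, zero_mul,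
    Finset.sum_ite_eq, Finset.mem_univ, if_true, Matrix.conjTranspose_apply, dftMatrix]
  simp only [stdAddChar_neg_mul_decimated, star_mul']
  simp only [star_stdAddChar, neg_neg, star_div₀, star_one, Complex.star_def, conj_ofReal]

/-- In the Fourier domain, decimation followed by zero filling is residue-class averaging. -/
lemma decimMatrix_mul_dftMatrix_gram (n_r n_c d_r d_c : ℕ) [NeZero n_r] [NeZero n_c] [NeZero d_r]
    [NeZero d_c] :
    (decimMatrix n_r n_c d_r d_c * (dftMatrix (n_r * d_r) (n_c * d_c))ᴴ)ᴴ *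
      (decimMatrix n_r n_c d_r d_c * (dftMatrix (n_r * d_r) (n_c * d_c))ᴴ) =
    Matrix.of fun p q => (1 / ((d_r : ℂ) * d_c)) *
      (if p.1.val % n_r = q.1.val % n_r ∧ p.2.val % n_c = q.2.val % n_c then 1 else 0) := by
  ext p q
  have hnr : (n_r : ℂ) ≠ 0 := NeZero.ne _
  have hnc : (n_c : ℂ) ≠ 0 := NeZero.ne _
  have hdr : (d_r : ℂ) ≠ 0 := NeZero.ne _
  have hdc : (d_c : ℂ) ≠ 0 := NeZero.ne _
  have key := congrArg₂ (· * ·)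
    (sum_stdAddChar_neg_mul n_r (p.1.val : ZMod n_r) (q.1.val : ZMod n_r))
    (sum_stdAddChar_neg_mul n_c (p.2.val : ZMod n_c) (q.2.val : ZMod n_c))
  simp only [Finset.sum_mul_sum] at key
  rw [← Fintype.sum_prod_type'] at key
  simp only [ZMod.natCast_eq_natCast_iff'] at key
  have hs := inv_sqrt_mul_self (x := ((n_r * d_r : ℕ) : ℝ) * (n_c * d_c : ℕ)) (by positivity)
  rw [Matrix.mul_apply]
  simp only [Matrix.conjTranspose_apply, decimMatrix_mul_dftMatrix_apply, Matrix.of_apply]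
  have : ∀ i : ZMod n_r × ZMod n_c,
      star ((1 / (Real.sqrt (((n_r * d_r : ℕ) : ℝ) * (n_c * d_c : ℕ)) : ℂ)) *
        ((ZMod.stdAddChar ((p.1.val : ZMod n_r) * i.1) : ℂ) *
          ZMod.stdAddChar ((p.2.val : ZMod n_c) * i.2))) *
      ((1 / (Real.sqrt (((n_r * d_r : ℕ) : ℝ) * (n_c * d_c : ℕ)) : ℂ)) *
        (ZMod.stdAddChar ((q.1.val : ZMod n_r) * i.1) *
          ZMod.stdAddChar ((q.2.val : ZMod n_c) * i.2))) =
      1 / ((((n_r * d_r : ℕ) : ℝ) * (n_c * d_c : ℕ) : ℝ) : ℂ) *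
        (ZMod.stdAddChar (-((p.1.val : ZMod n_r) * i.1)) *
            ZMod.stdAddChar ((q.1.val : ZMod n_r) * i.1) *
          (ZMod.stdAddChar (-((p.2.val : ZMod n_c) * i.2)) *
            ZMod.stdAddChar ((q.2.val : ZMod n_c) * i.2))) := fun i => by
    rw [← hs]
    simp only [star_mul', star_stdAddChar]
    simp only [star_div₀, star_one, Complex.star_def, conj_ofReal]
    ring
  simp only [this, ← Finset.mul_sum, key]
  by_cases h1 : p.1.val % n_r = q.1.val % n_r <;> by_cases h2 : p.2.val % n_c = q.2.val % n_c <;>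
    simp [h1, h2]
  field_simp

end DiscreteFourier

section LeastSquares

variable {m n : Type*} [Fintype m] [Fintype n]

lemma sum_normSq_mulVec_sub (A : Matrix m n ℂ) (b : m → ℂ) (x y : n → ℂ) :
    ∑ i, Complex.normSq ((A *ᵥ x) i - b i) =
      ∑ i, Complex.normSq ((A *ᵥ y) i - b i) + ∑ i, Complex.normSq ((A *ᵥ (x - y)) i)
        + 2 * (star (x - y) ⬝ᵥ (Aᴴ *ᵥ (A *ᵥ y - b))).re := by
  rw [Matrix.dotProduct_mulVec, ← Matrix.star_mulVec]
  simp only [dotProduct, Complex.re_sum, Finset.mul_sum, ← Finset.sum_add_distrib]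
  refine Finset.sum_congr rfl fun i _ => ?_
  simp only [Matrix.mulVec_sub, Pi.sub_apply, Pi.star_apply, Complex.normSq_apply, Complex.mul_re,
    Complex.star_def, Complex.conj_re, Complex.conj_im, Complex.sub_re, Complex.sub_im]
  ring

variable {κ : Type*} [Fintype κ]

/-- The generalized Tikhonov functional with blur `A`, data `b`, and regularisation terms
`L j`, `v j`. -/
noncomputable def tikhonov (μ ε : ℝ) (A : Matrix m n ℂ) (b : m → ℂ) (L : κ → Matrix n n ℂ)
    (v : κ → n → ℂ) (x : n → ℂ) : ℝ :=
  μ / 2 * (∑ i, Complex.normSq ((A *ᵥ x) i - b i))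
    + 1 / 2 * (∑ j, ∑ i, Complex.normSq ((L j *ᵥ x) i - v j i))
    + ε / 2 * (∑ i, Complex.normSq (x i))

lemma le_tikhonov_zero {μ : ℝ} (hμ : 0 < μ) (ε : ℝ) (A : Matrix m n ℂ)
    (L : κ → Matrix n n ℂ) (x : n → ℂ) :
    ε / 2 * ∑ i, Complex.normSq (x i) ≤ tikhonov μ ε A 0 L 0 x := by
  refine le_add_of_nonneg_left (add_nonneg ?_ ?_)
  · exact mul_nonneg (by positivity) (Finset.sum_nonneg fun i _ => Complex.normSq_nonneg _)
  · exact mul_nonneg (by positivity)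
      (Finset.sum_nonneg fun j _ => Finset.sum_nonneg fun i _ => Complex.normSq_nonneg _)

variable [DecidableEq n]

/-- The matrix of the normal equations of `tikhonov`. -/
noncomputable def tikhonovMatrix (μ ε : ℝ) (A : Matrix m n ℂ) (L : κ → Matrix n n ℂ) :
    Matrix n n ℂ :=
  (μ : ℂ) • (Aᴴ * A) + ∑ j, (L j)ᴴ * L j + (ε : ℂ) • 1

lemma isUnit_tikhonovMatrix {μ ε : ℝ} (hμ : 0 < μ) (hε : 0 < ε) (A : Matrix m n ℂ)
    (L : κ → Matrix n n ℂ) : IsUnit (tikhonovMatrix μ ε A L) := by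
  open scoped ComplexOrder in
  refine Matrix.PosDef.isUnit (Matrix.PosDef.posSemidef_add ?_ ?_)
  · exact ((Matrix.posSemidef_conjTranspose_mul_self A).smul (by exact_mod_cast hμ.le)).add
      (Matrix.posSemidef_sum _ fun j _ => Matrix.posSemidef_conjTranspose_mul_self (L j))
  · exact Matrix.PosDef.one.smul (by exact_mod_cast hε)

/-- At a solution of the normal equations the functional is expanded without linear term. -/
lemma tikhonov_eq_add (μ ε : ℝ) (A : Matrix m n ℂ) (b : m → ℂ) (L : κ → Matrix n n ℂ)
    (v : κ → n → ℂ) {y : n → ℂ}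
    (hy : tikhonovMatrix μ ε A L *ᵥ y = (μ : ℂ) • (Aᴴ *ᵥ b) + ∑ j, (L j)ᴴ *ᵥ v j)
    (x : n → ℂ) :
    tikhonov μ ε A b L v x = tikhonov μ ε A b L v y + tikhonov μ ε A 0 L 0 (x - y) := by
  have hgrad : (μ : ℂ) • (Aᴴ *ᵥ (A *ᵥ y - b)) + ∑ j, (L j)ᴴ *ᵥ (L j *ᵥ y - v j)
      + (ε : ℂ) • y = 0 := by
    rw [← sub_eq_zero.mpr hy]
    simp only [tikhonovMatrix, Matrix.add_mulVec, Matrix.smul_mulVec, Matrix.sum_mulVec,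
      Matrix.mulVec_sub, Matrix.mulVec_mulVec, Finset.sum_sub_distrib, smul_sub,
      Matrix.one_mulVec]
    abel
  have hre := congrArg (fun g => (star (x - y) ⬝ᵥ g).re) hgrad
  simp only [dotProduct_add, dotProduct_smul, dotProduct_sum, dotProduct_zero, Complex.add_re,
    smul_eq_mul, Complex.re_ofReal_mul, Complex.re_sum, Complex.zero_re] at hre
  have hA := sum_normSq_mulVec_sub A b x y
  have hL := fun j => sum_normSq_mulVec_sub (L j) (v j) x y
  have hI := sum_normSq_mulVec_sub (1 : Matrix n n ℂ) 0 x y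
  simp only [Matrix.one_mulVec, Matrix.conjTranspose_one, Pi.zero_apply, sub_zero] at hI
  simp only [tikhonov, hA, hL, hI, Finset.sum_add_distrib, ← Finset.mul_sum, Pi.zero_apply,
    sub_zero]
  linear_combination hre

/-- A solution of the normal equations is the unique minimizer of the Tikhonov functional. -/
theorem tikhonov_unique_minimizer {μ ε : ℝ} (hμ : 0 < μ) (hε : 0 < ε) (A : Matrix m n ℂ)
    (b : m → ℂ) (L : κ → Matrix n n ℂ) (v : κ → n → ℂ) {y : n → ℂ}
    (hy : tikhonovMatrix μ ε A L *ᵥ y = (μ : ℂ) • (Aᴴ *ᵥ b) + ∑ j, (L j)ᴴ *ᵥ v j) :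
    (∀ x, tikhonov μ ε A b L v y ≤ tikhonov μ ε A b L v x) ∧
      ∀ z, (∀ x, tikhonov μ ε A b L v z ≤ tikhonov μ ε A b L v x) → z = y := by
  have hquad := le_tikhonov_zero hμ ε A L
  have hnn : ∀ w : n → ℂ, 0 ≤ ∑ i, Complex.normSq (w i) := fun w =>
    Finset.sum_nonneg fun i _ => Complex.normSq_nonneg _
  constructor
  · intro x
    rw [tikhonov_eq_add μ ε A b L v hy x]
    exact le_add_of_nonneg_right ((mul_nonneg (by positivity) (hnn _)).trans (hquad _))
  · intro z hz
    have h1 := hz y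
    rw [tikhonov_eq_add μ ε A b L v hy z] at h1
    have h2 : ε / 2 * ∑ i, Complex.normSq ((z - y) i) ≤ 0 := (hquad (z - y)).trans (by linarith)
    have h3 : ∑ i, Complex.normSq ((z - y) i) = 0 :=
      le_antisymm (nonpos_of_mul_nonpos_right h2 (by positivity)) (hnn _)
    rw [Finset.sum_eq_zero_iff_of_nonneg fun i _ => Complex.normSq_nonneg _] at h3
    ext i
    exact sub_eq_zero.mp (Complex.normSq_eq_zero.mp (h3 i (Finset.mem_univ i)))

end LeastSquares

/-- Closed-form solution of the generalized Tikhonov super-resolution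
ℓ²-ℓ² problem in the Fourier domain:
`x*(μ) = F^H [ (μ/d)·Λ^H Q Λ + D ]⁻¹ ( μ·Λ^H F S^H b + Σ_j Γ_j^H F v_j )`,
where `Q` is the residue-class summation operator and `D` is pointwise multiplication by
`ζ + ε`. -/
theorem fsr_closed_form_minimizer
    (n_r n_c d_r d_c s : ℕ) [NeZero n_r] [NeZero n_c] [NeZero d_r] [NeZero d_c]
    (lam : ZMod (n_r * d_r) × ZMod (n_c * d_c) → ℂ)
    (gam : Fin s → ZMod (n_r * d_r) × ZMod (n_c * d_c) → ℂ)
    (eps μ : ℝ) (heps : 0 < eps) (hμ : 0 < μ)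
    (b : ZMod n_r × ZMod n_c → ℂ)
    (v : Fin s → ZMod (n_r * d_r) × ZMod (n_c * d_c) → ℂ) :
    let F := dft2 (n_r * d_r) (n_c * d_c)
    let Finv := idft2 (n_r * d_r) (n_c * d_c)
    -- blur operator K = F^H Λ F and regularisation operators L_j = F^H Γ_j F
    let K : (ZMod (n_r * d_r) × ZMod (n_c * d_c) → ℂ) → ZMod (n_r * d_r) × ZMod (n_c * d_c) → ℂ :=
      fun x => Finv (fun pq => lam pq * F x pq)
    let Lop : Fin s → (ZMod (n_r * d_r) × ZMod (n_c * d_c) → ℂ) → ZMod (n_r * d_r) × ZMod (n_c * d_c) → ℂ :=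
      fun j x => Finv (fun pq => gam j pq * F x pq)
    let f : (ZMod (n_r * d_r) × ZMod (n_c * d_c) → ℂ) → ℝ := fun x =>
      μ / 2 * (∑ ij : ZMod n_r × ZMod n_c,
          Complex.normSq (decim n_r n_c d_r d_c (K x) ij - b ij))
      + 1 / 2 * (∑ j : Fin s, ∑ pq : ZMod (n_r * d_r) × ZMod (n_c * d_c),
          Complex.normSq (Lop j x pq - v j pq))
      + eps / 2 * (∑ pq : ZMod (n_r * d_r) × ZMod (n_c * d_c), Complex.normSq (x pq))
    let zeta : ZMod (n_r * d_r) × ZMod (n_c * d_c) → ℝ := fun pq =>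
      ∑ j : Fin s, Complex.normSq (gam j pq)
    -- the matrix of the operator (μ/d)·Λ^H Q Λ + D on the Fourier side
    let Mop : Matrix (ZMod (n_r * d_r) × ZMod (n_c * d_c)) (ZMod (n_r * d_r) × ZMod (n_c * d_c)) ℂ :=
      Matrix.of fun pq pq' =>
        ((μ / ((d_r : ℝ) * d_c) : ℝ) : ℂ) * (starRingEnd ℂ) (lam pq) *
            (if pq.1.val % n_r = pq'.1.val % n_r ∧ pq.2.val % n_c = pq'.2.val % n_c
              then 1 else 0) * lam pq'
          + (if pq = pq' then ((zeta pq + eps : ℝ) : ℂ) else 0)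
    let rhs : ZMod (n_r * d_r) × ZMod (n_c * d_c) → ℂ := fun pq =>
      (μ : ℂ) * (starRingEnd ℂ) (lam pq) * F (zfill n_r n_c d_r d_c b) pq
        + ∑ j : Fin s, (starRingEnd ℂ) (gam j pq) * F (v j) pq
    let xstar := Finv (Mop⁻¹ *ᵥ rhs)
    (∀ x, f xstar ≤ f x) ∧ (∀ y, (∀ x, f y ≤ f x) → y = xstar) := by
  intro F Finv K Lop f zeta Mop rhs xstar
  set W := dftMatrix (n_r * d_r) (n_c * d_c)
  set S := decimMatrix n_r n_c d_r d_c
  have hW : W * Wᴴ = 1 := dftMatrix_mul_conjTranspose _ _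
  have hW' : Wᴴ * W = 1 := dftMatrix_conjTranspose_mul _ _
  have hmul : ∀ g x, Finv (fun pq => g pq * F x pq) = (Wᴴ * Matrix.diagonal g * W) *ᵥ x := by
    intro g x
    simp only [F, Finv, dft2_eq_mulVec, idft2_eq_mulVec, ← Matrix.mulVec_mulVec]
    congr 1
    ext pq
    rw [Matrix.mulVec_diagonal]
  set A := S * (Wᴴ * Matrix.diagonal lam * W) with hA
  set L : Fin s → Matrix _ _ ℂ := fun j => Wᴴ * Matrix.diagonal (gam j) * W with hL
  have hf : f = tikhonov μ eps A b L v := by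
    ext x
    simp only [f, K, Lop, hmul, decim_eq_mulVec, Matrix.mulVec_mulVec, tikhonov, A, L, S]
  have hM : Mop = W * tikhonovMatrix μ eps A L * Wᴴ := by
    have hAA : W * (Aᴴ * A) * Wᴴ =
        Matrix.diagonal (star lam) * ((S * Wᴴ)ᴴ * (S * Wᴴ)) * Matrix.diagonal lam := by
      simp only [hA, Matrix.conjTranspose_mul, Matrix.conjTranspose_conjTranspose,
        Matrix.diagonal_conjTranspose, Matrix.mul_assoc, hW, Matrix.mul_one]
      simp only [← Matrix.mul_assoc, hW, Matrix.one_mul]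
    have hLL : ∀ j, W * ((L j)ᴴ * L j) * Wᴴ =
        Matrix.diagonal (fun p => (Complex.normSq (gam j p) : ℂ)) := by
      intro j
      have : Matrix.diagonal (fun p => (Complex.normSq (gam j p) : ℂ)) =
          Matrix.diagonal (star (gam j)) * Matrix.diagonal (gam j) := by
        rw [Matrix.diagonal_mul_diagonal]
        congr 1
        ext p
        exact Complex.normSq_eq_conj_mul_self
      rw [this]
      simp only [hL, Matrix.conjTranspose_mul, Matrix.conjTranspose_conjTranspose,
        Matrix.diagonal_conjTranspose, Matrix.mul_assoc, hW, Matrix.mul_one]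
      simp only [← Matrix.mul_assoc, hW, Matrix.one_mul]
    have hgram := decimMatrix_mul_dftMatrix_gram n_r n_c d_r d_c
    simp only [tikhonovMatrix, Matrix.mul_add, Matrix.add_mul, Matrix.mul_smul, Matrix.smul_mul,
      Matrix.mul_sum, Matrix.sum_mul, hAA, hLL, Matrix.mul_one, hW]
    rw [show (S * Wᴴ)ᴴ * (S * Wᴴ) = _ from hgram]
    ext p q
    simp only [Mop, zeta, Matrix.add_apply, Matrix.smul_apply, Matrix.mul_diagonal,
      Matrix.diagonal_mul, Matrix.of_apply, Matrix.sum_apply, Matrix.diagonal_apply,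
      Matrix.one_apply, smul_eq_mul, Pi.star_apply, Complex.star_def, add_assoc]
    congr 1
    · push_cast
      ring
    · by_cases h : p = q <;> simp [h]
  have hunit : IsUnit Mop := by
    rw [hM]
    have hWu : IsUnit W := IsUnit.of_mul_eq_one _ hW
    have hWu' : IsUnit Wᴴ := IsUnit.of_mul_eq_one _ hW'
    exact (hWu.mul (isUnit_tikhonovMatrix hμ heps A L)).mul hWu'
  have hrhs : Wᴴ *ᵥ rhs = (μ : ℂ) • (Aᴴ *ᵥ b) + ∑ j, (L j)ᴴ *ᵥ v j := by
    have : rhs = (μ : ℂ) • (Matrix.diagonal (star lam) *ᵥ (W *ᵥ (Sᴴ *ᵥ b))) +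
        ∑ j, Matrix.diagonal (star (gam j)) *ᵥ (W *ᵥ v j) := by
      ext p
      simp only [rhs, F, W, S, dft2_eq_mulVec, zfill_eq_mulVec, Matrix.mulVec_diagonal, mul_assoc,
        Pi.add_apply, Pi.smul_apply, Finset.sum_apply, Pi.star_apply, smul_eq_mul,
        Complex.star_def]
    simp only [this, Matrix.mulVec_add, Matrix.mulVec_smul, Matrix.mulVec_sum, hA, hL,
      Matrix.conjTranspose_mul, Matrix.conjTranspose_conjTranspose,
      Matrix.diagonal_conjTranspose, Matrix.mulVec_mulVec, Matrix.mul_assoc]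
  have hnormal : tikhonovMatrix μ eps A L *ᵥ xstar =
      (μ : ℂ) • (Aᴴ *ᵥ b) + ∑ j, (L j)ᴴ *ᵥ v j := by
    have hH : tikhonovMatrix μ eps A L * Wᴴ = Wᴴ * Mop := by
      rw [hM, ← Matrix.mul_assoc, ← Matrix.mul_assoc, hW', Matrix.one_mul]
    rw [← hrhs]
    simp only [xstar, Finv, idft2_eq_mulVec]
    rw [Matrix.mulVec_mulVec, hH, Matrix.mulVec_mulVec, Matrix.mul_assoc,
      Matrix.mul_nonsing_inv _ ((Matrix.isUnit_iff_isUnit_det _).mp hunit), Matrix.mul_one]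
  rw [hf]
  exact tikhonov_unique_minimizer hμ heps A b L v hnormal
end

section
/- Let n, d be positive integers and index ℂ^{nd} by Fin n × Fin d. Let Λ ∈ ℂ^{(nd)×(nd)} be diagonal, let P ∈ ℂ^{(nd)×(nd)} be a permutation matrix, let Φ ∈ ℂ^{n×n} be diagonal, and define Λ̄ = (I_n ⊗ 1_dᵀ)·P·Λ ∈ ℂ^{n×(nd)}. Then Λ̄^H Φ Λ̄ = Pᵀ (Φ ⊗ I_d) P · Λ̄^H Λ̄. -/
open Matrix
open scoped Kronecker

/-- The matrix `I_n ⊗ 1_dᵀ` (summing over the second index), of size `n × (nd)`. -/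
def rowSum (n d : ℕ) : Matrix (Fin n) (Fin n × Fin d) ℂ :=
  Matrix.of fun i jl => if i = jl.1 then 1 else 0

/-- `(I_n ⊗ 1_d) A = (A ⊗ I_d) (I_n ⊗ 1_d)` for every square matrix `A`. -/
theorem rowSum_conjTranspose_mul (n d : ℕ) (A : Matrix (Fin n) (Fin n) ℂ) :
    (rowSum n d)ᴴ * A = (A ⊗ₖ (1 : Matrix (Fin d) (Fin d) ℂ)) * (rowSum n d)ᴴ := by
  ext ⟨j, l⟩ i
  simp [rowSum, Matrix.mul_apply, Fintype.sum_prod_type, Matrix.one_apply, apply_ite]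

theorem Equiv.Perm.permMatrix_mul_transpose {m R : Type*} [Fintype m] [DecidableEq m]
    [NonAssocSemiring R] (σ : Equiv.Perm m) : σ.permMatrix R * (σ.permMatrix R)ᵀ = 1 := by
  rw [Matrix.transpose_permMatrix, ← Matrix.permMatrix_mul, inv_mul_cancel, Matrix.permMatrix_one]

/-- Conjugation by a permutation matrix preserves diagonal matrices. -/
theorem Matrix.IsDiag.transpose_permMatrix_mul_mul {m R : Type*} [Fintype m] [DecidableEq m]
    [NonAssocSemiring R] {A : Matrix m m R} (hA : A.IsDiag) (σ : Equiv.Perm m) :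
    ((σ.permMatrix R)ᵀ * A * σ.permMatrix R).IsDiag := by
  rw [Matrix.transpose_permMatrix, Equiv.Perm.permMatrix, Equiv.Perm.permMatrix,
    PEquiv.toMatrix_toPEquiv_mul, PEquiv.mul_toMatrix_toPEquiv, Matrix.submatrix_submatrix]
  exact hA.submatrix (σ⁻¹).injective

theorem Matrix.IsDiag.commute {m R : Type*} [Fintype m] [DecidableEq m] [CommSemiring R]
    {A B : Matrix m m R} (hA : A.IsDiag) (hB : B.IsDiag) : Commute A B := by
  rw [← hA.diagonal_diag, ← hB.diagonal_diag]
  exact Matrix.commute_diagonal _ _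

/-- With `Λ̄ = (I_n ⊗ 1_dᵀ)·P·Λ`, `Λ` diagonal, `P` a permutation matrix
and `Φ` diagonal: `Λ̄^H Φ Λ̄ = Pᵀ (Φ ⊗ I_d) P · (Λ̄^H Λ̄)`. -/
theorem lamBar_conjTranspose_diag_mul
    (n d : ℕ) (Λ : Matrix (Fin n × Fin d) (Fin n × Fin d) ℂ) (hΛ : Λ.IsDiag)
    (σ : Equiv.Perm (Fin n × Fin d))
    (P : Matrix (Fin n × Fin d) (Fin n × Fin d) ℂ) (hP : P = σ.permMatrix ℂ)
    (Φ : Matrix (Fin n) (Fin n) ℂ) (hΦ : Φ.IsDiag) :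
    let Λb := rowSum n d * P * Λ
    Λbᴴ * Φ * Λb = Pᵀ * (Φ ⊗ₖ (1 : Matrix (Fin d) (Fin d) ℂ)) * P * (Λbᴴ * Λb) := by
  intro Λb
  set K := Φ ⊗ₖ (1 : Matrix (Fin d) (Fin d) ℂ) with hK
  have hPH : Pᴴ = Pᵀ := by rw [hP, Matrix.conjTranspose_permMatrix, Matrix.transpose_permMatrix]
  have hPP : P * Pᵀ = 1 := hP ▸ σ.permMatrix_mul_transpose
  have hD : (Pᵀ * K * P).IsDiag :=
    hP ▸ (hΦ.kronecker Matrix.isDiag_one).transpose_permMatrix_mul_mul σ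
  have hb : Λbᴴ = Λᴴ * Pᵀ * (rowSum n d)ᴴ := by
    simp only [Λb, Matrix.conjTranspose_mul, hPH, Matrix.mul_assoc]
  have key : Λbᴴ * Φ = Pᵀ * K * P * Λbᴴ := by
    calc Λbᴴ * Φ = Λᴴ * (Pᵀ * K * (P * Pᵀ)) * (rowSum n d)ᴴ := by
          rw [hb, Matrix.mul_assoc, rowSum_conjTranspose_mul, hPP, Matrix.mul_one]
          simp only [Matrix.mul_assoc, hK]
      _ = Λᴴ * (Pᵀ * K * P) * (Pᵀ * (rowSum n d)ᴴ) := by simp only [Matrix.mul_assoc]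
      _ = Pᵀ * K * P * Λbᴴ := by
          rw [(hΛ.conjTranspose.commute hD).eq, hb]
          simp only [Matrix.mul_assoc]
  rw [key, Matrix.mul_assoc]
end

section
/- Let q ∈ ℝ, w > 0 and β > 0. The function t ↦ w·|t| + (β/2)·(t − q)² has a unique global minimizer over ℝ, equal to sign(q)·max(|q| − w/β, 0). (This is the soft-thresholding closed form of the proximity operator of the weighted ℓ¹ regularizer.) -/
/-- The residual of soft-thresholding at level `c` is a subgradient of `c|·|` at the
thresholded point. -/
theorem soft_threshold_residual_subgradient (q : ℝ) {c : ℝ} (hc : 0 ≤ c) (t : ℝ) :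
    c * |Real.sign q * max (|q| - c) 0| +
      (t - Real.sign q * max (|q| - c) 0) * (q - Real.sign q * max (|q| - c) 0) ≤ c * |t| := by
  set m := Real.sign q * max (|q| - c) 0 with hm
  obtain ⟨hbound, hmul⟩ : |q - m| ≤ c ∧ m * (q - m) = c * |m| := by
    rcases le_total |q| c with h | h
    · have hm0 : m = 0 := by rw [hm, max_eq_right (by linarith), mul_zero]
      simp [hm0, h]
    · rw [max_eq_left (by linarith)] at hm
      rcases lt_trichotomy q 0 with hq | hq | hq
      · rw [abs_of_neg hq] at h hm
        have hmq : m = q + c := by rw [hm, Real.sign_of_neg hq]; ring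
        rw [hmq, abs_of_nonpos (by linarith : q + c ≤ 0), abs_le]
        exact ⟨⟨by linarith, by linarith⟩, by ring⟩
      · have hm0 : m = 0 := by rw [hm, hq, Real.sign_zero, zero_mul]
        simp [hm0, hq, hc]
      · rw [abs_of_pos hq] at h hm
        have hmq : m = q - c := by rw [hm, Real.sign_of_pos hq]; ring
        rw [hmq, abs_of_nonneg (by linarith : 0 ≤ q - c), abs_le]
        exact ⟨⟨by linarith, by linarith⟩, by ring⟩
  have ht : t * (q - m) ≤ c * |t| := calc
    t * (q - m) ≤ |t * (q - m)| := le_abs_self _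
    _ = |q - m| * |t| := by rw [abs_mul, mul_comm]
    _ ≤ c * |t| := by gcongr
  linarith [sub_mul t m (q - m)]

/-- Soft-thresholding: the unique global minimizer of
`t ↦ w|t| + (β/2)(t − q)²` is `sign(q)·max(|q| − w/β, 0)`. -/
theorem prox_weighted_l1_soft_threshold
    (q w β : ℝ) (hw : 0 < w) (hβ : 0 < β) :
    let f : ℝ → ℝ := fun t => w * |t| + β / 2 * (t - q) ^ 2
    let m : ℝ := Real.sign q * max (|q| - w / β) 0
    (∀ t, f m ≤ f t) ∧ (∀ t, (∀ s, f t ≤ f s) → t = m) := by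
  intro f m
  have growth (t : ℝ) : f m + β / 2 * (t - m) ^ 2 ≤ f t := by
    have h : w / β * |m| + (t - m) * (q - m) ≤ w / β * |t| :=
      soft_threshold_residual_subgradient q (div_pos hw hβ).le t
    have hscaled := mul_le_mul_of_nonneg_left h hβ.le
    have hwβ : β * (w / β) = w := mul_div_cancel₀ w hβ.ne'
    rw [mul_add, ← mul_assoc, ← mul_assoc β (w / β), hwβ] at hscaled
    simp only [f]
    linarith
  refine ⟨fun t => ?_, fun t ht => ?_⟩
  · have : 0 ≤ β / 2 * (t - m) ^ 2 := by positivity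
    linarith [growth t]
  · have hsq : (t - m) ^ 2 ≤ 0 := by
      have : β / 2 * (t - m) ^ 2 ≤ 0 := by linarith [growth t, ht m]
      exact nonpos_of_mul_nonpos_right this (half_pos hβ)
    exact sub_eq_zero.mp (pow_eq_zero_iff two_ne_zero |>.mp (le_antisymm hsq (sq_nonneg _)))
end
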